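/- arXiv:1312.7739 — 2 statements merged into one kernel-verified Lean document; each statement's English description precedes it below -/
import Mathlib

section
/- Let w : ℕ → ℝ with w_n > 0 for all n and let f = 1 − z (the sequence (1, −1, 0, 0, …)). Then the infimum over all polynomials p of ‖p·f − 1‖²_{H_w} equals (∑_{k=0}^∞ 1/w_k)^{−1} when the series ∑_{k=0}^∞ 1/w_k converges, and equals 0 when it diverges. In particular, f = 1 − z is cyclic in H_w if and only if ∑_{k=0}^∞ 1/w_k = ∞. -/
open scoped BigOperators ComplexConjugate
open Filter

def MemHw (w : ℕ → ℝ) (f : ℕ → ℂ) : Prop :=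
  Summable fun n => w n * ‖f n‖ ^ 2

noncomputable def normSqHw (w : ℕ → ℝ) (f : ℕ → ℂ) : ℝ :=
  ∑' n, w n * ‖f n‖ ^ 2

noncomputable def normHw (w : ℕ → ℝ) (f : ℕ → ℂ) : ℝ :=
  Real.sqrt (normSqHw w f)

noncomputable def innerHw (w : ℕ → ℝ) (f g : ℕ → ℂ) : ℂ :=
  ∑' n, (w n : ℂ) * f n * conj (g n)

noncomputable def cProd (f g : ℕ → ℂ) : ℕ → ℂ :=
  fun n => ∑ k ∈ Finset.range (n + 1), f k * g (n - k)

def onePS : ℕ → ℂ := fun n => if n = 0 then 1 else 0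

def IsPolySeq (p : ℕ → ℂ) : Prop := ∃ N, ∀ n, N < n → p n = 0

def DegLE (p : ℕ → ℂ) (n : ℕ) : Prop := ∀ m, n < m → p m = 0

def CyclicHw (w : ℕ → ℝ) (f : ℕ → ℂ) : Prop :=
  ∀ ε : ℝ, 0 < ε → ∃ p : ℕ → ℂ, IsPolySeq p ∧ normHw w (cProd p f - onePS) < ε

noncomputable def taylorCoeff (F : ℂ → ℂ) (n : ℕ) : ℂ :=
  iteratedDeriv n F 0 / (n.factorial : ℂ)

noncomputable def phiW (w : ℕ → ℝ) (k : ℕ) : ℝ :=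
  ∑ j ∈ Finset.range (k + 1), 1 / w j

def oneSubZ : ℕ → ℂ := fun k => if k = 0 then 1 else if k = 1 then -1 else 0

def zPow (i : ℕ) (f : ℕ → ℂ) : ℕ → ℂ :=
  fun m => if i ≤ m then f (m - i) else 0

lemma cProd_oneSubZ_zero (p : ℕ → ℂ) : cProd p oneSubZ 0 = p 0 := by
  simp [cProd, oneSubZ]

lemma cProd_oneSubZ_succ (p : ℕ → ℂ) (n : ℕ) :
    cProd p oneSubZ (n + 1) = p (n + 1) - p n := by
  unfold cProd
  rw [Finset.sum_range_succ, Finset.sum_range_succ, Finset.sum_eq_zero]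
  · simp [oneSubZ]
    ring
  · intro k hk
    have hk' := Finset.mem_range.1 hk
    have h0 : n + 1 - k ≠ 0 := by omega
    have h1 : n + 1 - k ≠ 1 := by omega
    simp [oneSubZ, h0, h1]

lemma sum_cProd_oneSubZ (p : ℕ → ℂ) (M : ℕ) :
    ∑ n ∈ Finset.range (M + 1), cProd p oneSubZ n = p M := by
  induction M with
  | zero => simp [cProd_oneSubZ_zero]
  | succ M ih => rw [Finset.sum_range_succ, ih, cProd_oneSubZ_succ]; ring

lemma sum_onePS (M : ℕ) : ∑ n ∈ Finset.range (M + 1), onePS n = 1 := by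
  simp [onePS]

lemma phiW_pos {w : ℕ → ℝ} (hw : ∀ n, 0 < w n) (M : ℕ) : 0 < phiW w M :=
  Finset.sum_pos (fun n _ => one_div_pos.2 (hw n)) ⟨0, by simp⟩

lemma phiW_mono {w : ℕ → ℝ} (hw : ∀ n, 0 < w n) : Monotone (phiW w) := by
  refine monotone_nat_of_le_succ fun n => ?_
  have h : 0 < 1 / w (n + 1) := one_div_pos.2 (hw _)
  unfold phiW
  rw [Finset.sum_range_succ _ (n + 1)]
  linarith

/-- Every approximation error is bounded below by some `(phiW w M)⁻¹` (Cauchy–Schwarz). -/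
lemma exists_inv_phiW_le_normSqHw {w : ℕ → ℝ} (hw : ∀ n, 0 < w n) {p : ℕ → ℂ}
    (hp : IsPolySeq p) : ∃ M, (phiW w M)⁻¹ ≤ normSqHw w (cProd p oneSubZ - onePS) := by
  obtain ⟨N, hN⟩ := hp
  refine ⟨N + 1, ?_⟩
  set g := cProd p oneSubZ - onePS with hg
  have hsupp : ∀ n ∉ Finset.range (N + 1 + 1), w n * ‖g n‖ ^ 2 = 0 := by
    intro n hn
    have hn' : N + 1 < n := by simpa using hn
    obtain ⟨m, rfl⟩ : ∃ m, n = m + 1 := ⟨n - 1, by omega⟩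
    have : g (m + 1) = 0 := by
      simp [hg, cProd_oneSubZ_succ, hN (m + 1) (by omega), hN m (by omega), onePS]
    simp [this]
  have hnorm : normSqHw w g = ∑ n ∈ Finset.range (N + 1 + 1), w n * ‖g n‖ ^ 2 :=
    tsum_eq_sum hsupp
  have hsum : ∑ n ∈ Finset.range (N + 1 + 1), g n = -1 := by
    simp only [hg, Pi.sub_apply, Finset.sum_sub_distrib]
    rw [sum_cProd_oneSubZ, sum_onePS, hN (N + 1) (by omega)]
    simp
  have hone : (1 : ℝ) ≤ ∑ n ∈ Finset.range (N + 1 + 1), ‖g n‖ := by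
    have := norm_sum_le (Finset.range (N + 1 + 1)) g
    rw [hsum] at this
    simpa using this
  have hcs : (∑ n ∈ Finset.range (N + 1 + 1), ‖g n‖) ^ 2 ≤
      phiW w (N + 1) * ∑ n ∈ Finset.range (N + 1 + 1), w n * ‖g n‖ ^ 2 := by
    refine Finset.sum_sq_le_sum_mul_sum_of_sq_le_mul _
      (fun n _ => (one_div_pos.2 (hw n)).le)
      (fun n _ => mul_nonneg (hw n).le (sq_nonneg _)) fun n _ => le_of_eq ?_
    have := (hw n).ne'
    field_simp
  rw [hnorm, inv_le_iff_one_le_mul₀' (phiW_pos hw _)]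
  nlinarith

/-- The value `(phiW w M)⁻¹` is attained by a polynomial. -/
lemma exists_normSqHw_eq_inv_phiW {w : ℕ → ℝ} (hw : ∀ n, 0 < w n) (M : ℕ) :
    ∃ p : ℕ → ℂ, IsPolySeq p ∧ (phiW w M)⁻¹ = normSqHw w (cProd p oneSubZ - onePS) := by
  have hS := phiW_pos hw M
  set S := phiW w M with hSdef
  set p : ℕ → ℂ := fun n => if n ≤ M then ((1 - phiW w n / S : ℝ) : ℂ) else 0 with hp
  have hpM : p M = 0 := by
    have hS' : (S : ℂ) ≠ 0 := by exact_mod_cast hS.ne'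
    simp [hp, ← hSdef, div_self hS']
  have hbig : ∀ n, M ≤ n → p n = 0 := by
    intro n hn
    rcases hn.eq_or_lt with rfl | h
    · exact hpM
    · simp [hp, h]
  refine ⟨p, ⟨M, fun n hn => hbig n hn.le⟩, ?_⟩
  have hg : ∀ n ≤ M, (cProd p oneSubZ - onePS) n = ((-(1 / w n / S) : ℝ) : ℂ) := by
    intro n hn
    cases n with
    | zero => simp [cProd_oneSubZ_zero, hp, onePS, phiW]
    | succ m =>
      have hsucc : phiW w (m + 1) = phiW w m + 1 / w (m + 1) := Finset.sum_range_succ _ _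
      simp only [Pi.sub_apply, cProd_oneSubZ_succ, hp, onePS, if_pos hn,
        if_pos (show m ≤ M by omega), hsucc]
      push_cast
      simp
      ring
  have hsupp : ∀ n ∉ Finset.range (M + 1), w n * ‖(cProd p oneSubZ - onePS) n‖ ^ 2 = 0 := by
    intro n hn
    have hn' : M + 1 ≤ n := by simpa using hn
    obtain ⟨m, rfl⟩ : ∃ m, n = m + 1 := ⟨n - 1, by omega⟩
    simp [cProd_oneSubZ_succ, hbig (m + 1) (by omega), hbig m (by omega), onePS]
  have hterm : ∀ n ∈ Finset.range (M + 1),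
      w n * ‖(cProd p oneSubZ - onePS) n‖ ^ 2 = 1 / w n * (S⁻¹ ^ 2) := by
    intro n hn
    rw [hg n (by simpa [Nat.lt_succ_iff] using hn), Complex.norm_real, Real.norm_eq_abs, sq_abs]
    have := (hw n).ne'
    field_simp
  unfold normSqHw
  rw [tsum_eq_sum hsupp, Finset.sum_congr rfl hterm, ← Finset.sum_mul]
  change S⁻¹ = S * _
  field_simp

lemma sInf_normSqHw_eq_of_tendsto {w : ℕ → ℝ} (hw : ∀ n, 0 < w n) {L : ℝ}
    (hL : Tendsto (fun M => (phiW w M)⁻¹) atTop (nhds L)) :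
    sInf {x : ℝ | ∃ p : ℕ → ℂ, IsPolySeq p ∧ x = normSqHw w (cProd p oneSubZ - onePS)} = L := by
  have hanti : Antitone fun M => (phiW w M)⁻¹ := fun _ _ h =>
    inv_anti₀ (phiW_pos hw _) (phiW_mono hw h)
  refine IsGLB.csInf_eq ⟨?_, fun b hb => ?_⟩ ⟨_, exists_normSqHw_eq_inv_phiW hw 0⟩
  · rintro _ ⟨p, hp, rfl⟩
    obtain ⟨M, hM⟩ := exists_inv_phiW_le_normSqHw hw hp
    exact (hanti.le_of_tendsto hL M).trans hM
  · exact ge_of_tendsto' hL fun M => hb (exists_normSqHw_eq_inv_phiW hw M)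

lemma tendsto_inv_phiW_zero {w : ℕ → ℝ} (hw : ∀ n, 0 < w n)
    (h : ¬ Summable fun k => 1 / w k) :
    Tendsto (fun M => (phiW w M)⁻¹) atTop (nhds 0) :=
  tendsto_inv_atTop_zero.comp <| (tendsto_add_atTop_iff_nat 1).2 <|
    (not_summable_iff_tendsto_nat_atTop_of_nonneg fun n => (one_div_pos.2 (hw n)).le).1 h

theorem optimal_norm_and_cyclicity_one_sub_z
    (w : ℕ → ℝ) (hw : ∀ n, 0 < w n) :
    ((Summable fun k => 1 / w k) →
      sInf {x : ℝ | ∃ p : ℕ → ℂ, IsPolySeq p ∧ x = normSqHw w (cProd p oneSubZ - onePS)}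
        = (∑' k, 1 / w k)⁻¹) ∧
    (¬ (Summable fun k => 1 / w k) →
      sInf {x : ℝ | ∃ p : ℕ → ℂ, IsPolySeq p ∧ x = normSqHw w (cProd p oneSubZ - onePS)}
        = 0) ∧
    (CyclicHw w oneSubZ ↔ ¬ Summable fun k => 1 / w k) := by
  refine ⟨fun h => ?_, fun h => sInf_normSqHw_eq_of_tendsto hw (tendsto_inv_phiW_zero hw h),
    fun hc h => ?_, fun h ε hε => ?_⟩
  · have hT : 0 < ∑' k, 1 / w k :=
      h.tsum_pos (fun n => (one_div_pos.2 (hw n)).le) 0 (one_div_pos.2 (hw 0))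
    exact sInf_normSqHw_eq_of_tendsto hw
      (((tendsto_add_atTop_iff_nat 1).2 h.hasSum.tendsto_sum_nat).inv₀ hT.ne')
  · have hT : 0 < ∑' k, 1 / w k :=
      h.tsum_pos (fun n => (one_div_pos.2 (hw n)).le) 0 (one_div_pos.2 (hw 0))
    obtain ⟨p, hp, hlt⟩ := hc (Real.sqrt (∑' k, 1 / w k)⁻¹) (Real.sqrt_pos.2 (inv_pos.2 hT))
    obtain ⟨M, hM⟩ := exists_inv_phiW_le_normSqHw hw hp
    have hle : phiW w M ≤ ∑' k, 1 / w k :=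
      h.sum_le_tsum _ fun n _ => (one_div_pos.2 (hw n)).le
    exact hlt.not_ge (Real.sqrt_le_sqrt ((inv_anti₀ (phiW_pos hw M) hle).trans hM))
  · obtain ⟨M, hM⟩ :=
      ((tendsto_inv_phiW_zero hw h).eventually_lt_const (pow_pos hε 2)).exists
    obtain ⟨p, hp, hpM⟩ := exists_normSqHw_eq_inv_phiW hw M
    refine ⟨p, hp, ?_⟩
    rw [normHw, ← hpM]
    exact (Real.sqrt_lt' hε).2 hM
end

section
/- Let f be a polynomial (over ℂ) of degree t ≥ 1 with f(z) ≠ 0 for all |z| < 1 and such that every zero z₀ of f with |z₀| = 1 is simple. Let ĝ(k) denote the k-th Taylor coefficient at 0 of the function 1/f (which is analytic on the open unit disc), let f̂(j) be the j-th coefficient of f (zero for j > t), and set φ(k) = ∑_{j=0}^k 1/w_j. Then there exists a constant C > 0 such that for all n ≥ 0: |∑_{k=0}^n φ(k) ĝ(k) f̂(n−k)| ≤ C/w_n. -/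
open scoped BigOperators ComplexConjugate
open Filter

/-- A formal power series with bounded coefficients. -/
def BoundedCoeff (g : PowerSeries ℂ) : Prop := ∃ M : ℝ, ∀ k, ‖PowerSeries.coeff k g‖ ≤ M

theorem BoundedCoeff.add {g h : PowerSeries ℂ} (hg : BoundedCoeff g) (hh : BoundedCoeff h) :
    BoundedCoeff (g + h) := by
  obtain ⟨M, hM⟩ := hg
  obtain ⟨N, hN⟩ := hh
  refine ⟨M + N, fun k => ?_⟩
  rw [map_add]
  exact (norm_add_le _ _).trans (add_le_add (hM k) (hN k))

theorem BoundedCoeff.C_mul {g : PowerSeries ℂ} (hg : BoundedCoeff g) (c : ℂ) :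
    BoundedCoeff (PowerSeries.C c * g) := by
  obtain ⟨M, hM⟩ := hg
  refine ⟨‖c‖ * M, fun k => ?_⟩
  rw [PowerSeries.coeff_C_mul, norm_mul]
  exact mul_le_mul_of_nonneg_left (hM k) (norm_nonneg c)

theorem BoundedCoeff.X_mul {g : PowerSeries ℂ} (hg : BoundedCoeff g) :
    BoundedCoeff (PowerSeries.X * g) := by
  obtain ⟨M, hM⟩ := hg
  refine ⟨M, fun k => ?_⟩
  cases k with
  | zero => simpa using (norm_nonneg _).trans (hM 0)
  | succ k => rw [PowerSeries.coeff_succ_X_mul]; exact hM k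

theorem BoundedCoeff.polynomial_mul {g : PowerSeries ℂ} (hg : BoundedCoeff g)
    (p : Polynomial ℂ) : BoundedCoeff ((p : PowerSeries ℂ) * g) := by
  induction p using Polynomial.induction_on' with
  | add p q hp hq =>
    rw [Polynomial.coe_add, add_mul]
    exact hp.add hq
  | monomial n c =>
    rw [← Polynomial.C_mul_X_pow_eq_monomial, Polynomial.coe_mul, Polynomial.coe_C,
      Polynomial.coe_pow, Polynomial.coe_X, mul_assoc]
    refine BoundedCoeff.C_mul ?_ c
    induction n with
    | zero => simpa using hg
    | succ n ih =>
      rw [pow_succ', mul_assoc]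
      exact ih.X_mul

theorem coeff_eq_of_X_sub_C_mul_eq {r : ℂ} {g h : PowerSeries ℂ}
    (e : (PowerSeries.X - PowerSeries.C r) * g = h) :
    r * PowerSeries.coeff 0 g = -PowerSeries.coeff 0 h ∧
      ∀ k, r * PowerSeries.coeff (k + 1) g = PowerSeries.coeff k g - PowerSeries.coeff (k + 1) h := by
  subst e
  refine ⟨?_, fun k => ?_⟩
  · rw [sub_mul, map_sub, PowerSeries.coeff_zero_X_mul, PowerSeries.coeff_C_mul]
    ring
  · rw [sub_mul, map_sub, PowerSeries.coeff_succ_X_mul, PowerSeries.coeff_C_mul]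
    ring

theorem BoundedCoeff.of_X_sub_C_mul {r : ℂ} (hr : 1 < ‖r‖) {g h : PowerSeries ℂ}
    (e : (PowerSeries.X - PowerSeries.C r) * g = h) (hh : BoundedCoeff h) : BoundedCoeff g := by
  obtain ⟨H, hH⟩ := hh
  obtain ⟨e0, e1⟩ := coeff_eq_of_X_sub_C_mul_eq e
  have hH0 : 0 ≤ H := (norm_nonneg _).trans (hH 0)
  have hr' : 0 < ‖r‖ - 1 := by linarith
  have hM : ‖r‖ * (H / (‖r‖ - 1)) = H / (‖r‖ - 1) + H := by
    field_simp
    ring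
  refine ⟨H / (‖r‖ - 1), fun k => ?_⟩
  induction k with
  | zero =>
    have h0 := congrArg norm e0
    rw [norm_mul, norm_neg] at h0
    have : 0 ≤ H / (‖r‖ - 1) := by positivity
    refine le_of_mul_le_mul_left ?_ (zero_lt_one.trans hr)
    linarith [hH 0]
  | succ k ih =>
    have h1 := congrArg norm (e1 k)
    rw [norm_mul] at h1
    refine le_of_mul_le_mul_left ?_ (zero_lt_one.trans hr)
    linarith [hH (k + 1),
      norm_sub_le (PowerSeries.coeff k g) (PowerSeries.coeff (k + 1) h)]

theorem boundedCoeff_of_X_sub_C_mul_eq_one {r : ℂ} (hr : ‖r‖ = 1) {g : PowerSeries ℂ}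
    (e : (PowerSeries.X - PowerSeries.C r) * g = 1) : BoundedCoeff g := by
  obtain ⟨e0, e1⟩ := coeff_eq_of_X_sub_C_mul_eq e
  refine ⟨1, fun k => ?_⟩
  induction k with
  | zero =>
    have h0 := congrArg norm e0
    rw [norm_mul, hr, one_mul] at h0
    rw [h0]
    simp
  | succ k ih =>
    have h1 := congrArg norm (e1 k)
    rw [norm_mul, hr, one_mul] at h1
    rw [h1]
    simpa [PowerSeries.coeff_one] using ih

/-- The reciprocal of a polynomial without zeros in the open unit disc and with only simple
zeros on the unit circle has bounded Taylor coefficients. -/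
theorem exists_boundedCoeff_mul_eq_one (f : Polynomial ℂ)
    (hf0 : ∀ z : ℂ, ‖z‖ < 1 → f.eval z ≠ 0)
    (hsimple : ∀ z : ℂ, ‖z‖ = 1 → f.eval z = 0 → (Polynomial.derivative f).eval z ≠ 0) :
    ∃ g : PowerSeries ℂ, (f : PowerSeries ℂ) * g = 1 ∧ BoundedCoeff g := by
  induction hn : f.natDegree generalizing f with
  | zero =>
    rw [Polynomial.natDegree_eq_zero] at hn
    obtain ⟨c, rfl⟩ := hn
    have hc : c ≠ 0 := by simpa using hf0 0 (by simp)
    refine ⟨PowerSeries.C c⁻¹, ?_, ‖c⁻¹‖, fun k => ?_⟩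
    · rw [Polynomial.coe_C, ← map_mul, mul_inv_cancel₀ hc, map_one]
    · rw [PowerSeries.coeff_C]
      split_ifs
      · exact le_rfl
      · simp
  | succ n ih =>
    have hdeg : 0 < f.degree := Polynomial.natDegree_pos_iff_degree_pos.mp (by omega)
    obtain ⟨r, hr⟩ := Complex.exists_root hdeg
    obtain ⟨q, rfl⟩ := Polynomial.dvd_iff_isRoot.mpr hr
    have hq : q ≠ 0 := by
      rintro rfl
      simp at hn
    have hqn : q.natDegree = n := by
      rw [Polynomial.natDegree_mul (Polynomial.X_sub_C_ne_zero r) hq,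
        Polynomial.natDegree_X_sub_C] at hn
      omega
    have hr1 : 1 ≤ ‖r‖ := by
      by_contra! h
      exact hf0 r h hr
    obtain ⟨h, hqh, hb⟩ := ih q
      (fun z hz hqz => hf0 z hz (by rw [Polynomial.eval_mul, hqz, mul_zero]))
      (fun z hz hqz hd => hsimple z hz (by rw [Polynomial.eval_mul, hqz, mul_zero])
        (by simp [Polynomial.derivative_mul, hqz, hd])) hqn
    have hcoe : ((Polynomial.X - Polynomial.C r : Polynomial ℂ) : PowerSeries ℂ)
        = PowerSeries.X - PowerSeries.C r := by
      rw [Polynomial.coe_sub, Polynomial.coe_X, Polynomial.coe_C]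
    have hr0 : r ≠ 0 := by
      rintro rfl
      norm_num at hr1
    have hu : (PowerSeries.X - PowerSeries.C r) * (PowerSeries.X - PowerSeries.C r)⁻¹ = 1 :=
      PowerSeries.mul_inv_cancel _ (by simpa using hr0)
    set u : PowerSeries ℂ := (PowerSeries.X - PowerSeries.C r)⁻¹
    refine ⟨u * h, ?_, ?_⟩
    · rw [Polynomial.coe_mul, hcoe]
      linear_combination (q : PowerSeries ℂ) * h * hu + hqh
    · rcases hr1.eq_or_lt with h1 | h1
      · have hqr : q.eval r ≠ 0 := by
          intro hqr
          exact hsimple r h1.symm hr (by simp [Polynomial.derivative_mul, hqr])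
        have hcop : IsCoprime (Polynomial.X - Polynomial.C r) q :=
          (Polynomial.irreducible_X_sub_C r).coprime_iff_not_dvd.mpr
            (fun hd => hqr (Polynomial.dvd_iff_isRoot.mp hd))
        obtain ⟨a, b, hab⟩ := hcop
        have hab' := congrArg (fun p : Polynomial ℂ => (p : PowerSeries ℂ)) hab
        simp only [Polynomial.coe_add, Polynomial.coe_mul, hcoe, Polynomial.coe_one] at hab'
        have : u * h = (a : PowerSeries ℂ) * h + (b : PowerSeries ℂ) * u := by
          linear_combination (-u * h) * hab' + (a : PowerSeries ℂ) * h * hu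
            + (b : PowerSeries ℂ) * u * hqh
        rw [this]
        exact (hb.polynomial_mul a).add
          ((boundedCoeff_of_X_sub_C_mul_eq_one h1.symm hu).polynomial_mul b)
      · exact hb.of_X_sub_C_mul h1 (g := u * h) (by rw [← mul_assoc, hu, one_mul])

theorem iteratedDeriv_polynomial_eval (p : Polynomial ℂ) (n : ℕ) :
    iteratedDeriv n (fun z => p.eval z) = fun z => (Polynomial.derivative^[n] p).eval z := by
  induction n with
  | zero => simp
  | succ n ih =>
    rw [iteratedDeriv_succ, ih, Function.iterate_succ_apply']
    funext z
    exact Polynomial.deriv _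

theorem taylorCoeff_polynomial (p : Polynomial ℂ) (n : ℕ) :
    taylorCoeff (fun z => p.eval z) n = p.coeff n := by
  have : (n.factorial : ℂ) ≠ 0 := by exact_mod_cast n.factorial_ne_zero
  rw [taylorCoeff, iteratedDeriv_polynomial_eval]
  beta_reduce
  rw [← Polynomial.coeff_zero_eq_eval_zero,
    Polynomial.coeff_iterate_derivative, zero_add, Nat.descFactorial_self, nsmul_eq_mul]
  field_simp

theorem taylorCoeff_mul {F G : ℂ → ℂ} (hF : AnalyticAt ℂ F 0) (hG : AnalyticAt ℂ G 0) (n : ℕ) :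
    taylorCoeff (F * G) n = ∑ k ∈ Finset.range (n + 1), taylorCoeff F k * taylorCoeff G (n - k) := by
  rw [taylorCoeff, iteratedDeriv_mul hF.contDiffAt hG.contDiffAt, Finset.sum_div]
  refine Finset.sum_congr rfl fun k hk => ?_
  have hkn : k ≤ n := Nat.lt_succ_iff.mp (Finset.mem_range.mp hk)
  have h1 : (n.factorial : ℂ) ≠ 0 := by exact_mod_cast n.factorial_ne_zero
  have h2 : (k.factorial : ℂ) ≠ 0 := by exact_mod_cast k.factorial_ne_zero
  have h3 : ((n - k).factorial : ℂ) ≠ 0 := by exact_mod_cast (n - k).factorial_ne_zero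
  rw [taylorCoeff, taylorCoeff, Nat.cast_choose ℂ hkn]
  field_simp

theorem coe_mul_mk_taylorCoeff_inv (f : Polynomial ℂ) (hf : f.eval 0 ≠ 0) :
    (f : PowerSeries ℂ) * PowerSeries.mk (taylorCoeff fun z => (f.eval z)⁻¹) = 1 := by
  have hF : AnalyticAt ℂ (fun z => f.eval z) 0 :=
    f.differentiable.analyticAt 0
  have hG : AnalyticAt ℂ (fun z => (f.eval z)⁻¹) 0 := hF.inv hf
  have hev : ((fun z => f.eval z) * fun z => (f.eval z)⁻¹) =ᶠ[nhds 0]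
      fun z => (1 : Polynomial ℂ).eval z := by
    filter_upwards [hF.continuousAt.eventually_ne hf] with z hz
    simp [mul_inv_cancel₀ hz]
  ext n
  rw [PowerSeries.coeff_mul, Finset.Nat.sum_antidiagonal_eq_sum_range_succ_mk]
  simp only [Polynomial.coeff_coe, PowerSeries.coeff_mk, ← taylorCoeff_polynomial f]
  rw [← taylorCoeff_mul hF hG, ← Polynomial.coe_one, Polynomial.coeff_coe,
    ← taylorCoeff_polynomial, taylorCoeff, taylorCoeff, hev.iteratedDeriv_eq n]

theorem exists_norm_taylorCoeff_inv_le (f : Polynomial ℂ)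
    (hf0 : ∀ z : ℂ, ‖z‖ < 1 → f.eval z ≠ 0)
    (hsimple : ∀ z : ℂ, ‖z‖ = 1 → f.eval z = 0 → (Polynomial.derivative f).eval z ≠ 0) :
    ∃ M : ℝ, ∀ k, ‖taylorCoeff (fun z => (f.eval z)⁻¹) k‖ ≤ M := by
  obtain ⟨g, hg, M, hM⟩ := exists_boundedCoeff_mul_eq_one f hf0 hsimple
  have ht := coe_mul_mk_taylorCoeff_inv f (hf0 0 (by simp))
  have : g = PowerSeries.mk (taylorCoeff fun z => (f.eval z)⁻¹) :=
    left_inv_eq_right_inv (by rw [mul_comm, hg]) ht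
  refine ⟨M, fun k => ?_⟩
  simpa [this] using hM k

theorem sum_taylorCoeff_inv_mul_coeff (f : Polynomial ℂ) (hf : f.eval 0 ≠ 0) (n : ℕ) :
    ∑ k ∈ Finset.range (n + 1), taylorCoeff (fun z => (f.eval z)⁻¹) k * f.coeff (n - k)
      = if n = 0 then 1 else 0 := by
  have h := congrArg (PowerSeries.coeff n) (coe_mul_mk_taylorCoeff_inv f hf)
  rw [mul_comm, PowerSeries.coeff_mul, Finset.Nat.sum_antidiagonal_eq_sum_range_succ_mk,
    PowerSeries.coeff_one] at h
  simpa only [Polynomial.coeff_coe, PowerSeries.coeff_mk] using h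

theorem exists_one_le_and_forall_succ_le_mul {w : ℕ → ℝ} (hw : ∀ n, 0 < w n)
    (hw1 : Tendsto (fun n => w (n + 1) / w n) atTop (nhds 1)) :
    ∃ K : ℝ, 1 ≤ K ∧ ∀ n, w (n + 1) ≤ K * w n := by
  obtain ⟨K, hK⟩ := hw1.bddAbove_range
  refine ⟨max K 1, le_max_right _ _, fun n => ?_⟩
  rw [← div_le_iff₀ (hw n)]
  exact (hK ⟨n, rfl⟩).trans (le_max_left _ _)

theorem phiW_add_sub_phiW_mem_Icc {w : ℕ → ℝ} (hw : ∀ n, 0 < w n) {K : ℝ} (hK1 : 1 ≤ K)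
    (hK : ∀ n, w (n + 1) ≤ K * w n) (k m : ℕ) :
    phiW w (k + m) - phiW w k ∈ Set.Icc 0 (m * K ^ m / w (k + m)) := by
  induction m with
  | zero => simp
  | succ m ih =>
    have e : phiW w (k + (m + 1)) = phiW w (k + m) + 1 / w (k + m + 1) := by
      rw [phiW, ← add_assoc, Finset.sum_range_succ, phiW]
    have hp := hw (k + m)
    have hp' := hw (k + m + 1)
    have hinv : 1 / w (k + m) ≤ K / w (k + m + 1) := by
      rw [div_le_div_iff₀ hp hp', one_mul]
      exact hK _
    have hpow : 1 ≤ K ^ (m + 1) := one_le_pow₀ hK1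
    have hone : 1 / w (k + m + 1) ≤ K ^ (m + 1) / w (k + m + 1) := by gcongr
    have hmul : m * K ^ m * (1 / w (k + m)) ≤ m * K ^ m * (K / w (k + m + 1)) := by gcongr
    have hpos : 0 < 1 / w (k + m + 1) := by positivity
    rw [e]
    refine ⟨by linarith [ih.1], ?_⟩
    have hsum : ((m + 1 : ℕ) : ℝ) * K ^ (m + 1) / w (k + (m + 1))
        = m * K ^ m * (K / w (k + m + 1)) + K ^ (m + 1) / w (k + m + 1) := by
      rw [← add_assoc]
      push_cast
      ring
    have hih := ih.2
    rw [hsum]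
    rw [← mul_one_div] at hih
    linarith

theorem abs_phiW_sub_phiW_le {w : ℕ → ℝ} (hw : ∀ n, 0 < w n) {K : ℝ} (hK1 : 1 ≤ K)
    (hK : ∀ n, w (n + 1) ≤ K * w n) {k n t : ℕ} (hkn : k ≤ n) (hnk : n - k ≤ t) :
    |phiW w k - phiW w n| ≤ t * K ^ t / w n := by
  obtain ⟨m, rfl⟩ := Nat.exists_eq_add_of_le hkn
  rw [Nat.add_sub_cancel_left] at hnk
  have h := phiW_add_sub_phiW_mem_Icc hw hK1 hK k m
  rw [abs_sub_comm, abs_of_nonneg h.1]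
  refine h.2.trans ?_
  have := hw (k + m)
  gcongr

theorem sum_norm_coeff_sub_le (f : Polynomial ℂ) (n : ℕ) :
    ∑ k ∈ Finset.range (n + 1), ‖f.coeff (n - k)‖ ≤ ∑ i ∈ f.support, ‖f.coeff i‖ := by
  have h := Finset.sum_range_reflect (fun i => ‖f.coeff i‖) (n + 1)
  simp only [Nat.add_sub_cancel] at h
  rw [h]
  rw [← Finset.sum_filter_ne_zero]
  refine Finset.sum_le_sum_of_subset_of_nonneg (fun i hi => ?_) fun i _ _ => norm_nonneg _
  simpa using (Finset.mem_filter.mp hi).2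

theorem convolution_bound_for_simple_zero_polynomials
    (w : ℕ → ℝ) (hw : ∀ n, 0 < w n)
    (hw1 : Filter.Tendsto (fun n => w (n + 1) / w n) Filter.atTop (nhds 1))
    (f : Polynomial ℂ) (ht : 1 ≤ f.natDegree)
    (hf0 : ∀ z : ℂ, ‖z‖ < 1 → f.eval z ≠ 0)
    (hsimple : ∀ z : ℂ, ‖z‖ = 1 → f.eval z = 0 → (Polynomial.derivative f).eval z ≠ 0) :
    ∃ C : ℝ, 0 < C ∧ ∀ n : ℕ,
      ‖∑ k ∈ Finset.range (n + 1),
          (phiW w k : ℂ) * taylorCoeff (fun z => (f.eval z)⁻¹) k * f.coeff (n - k)‖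
        ≤ C / w n := by
  obtain ⟨M, hM⟩ := exists_norm_taylorCoeff_inv_le f hf0 hsimple
  obtain ⟨K, hK1, hK⟩ := exists_one_le_and_forall_succ_le_mul hw hw1
  have hM0 : 0 ≤ M := (norm_nonneg _).trans (hM 0)
  set g := taylorCoeff (fun z => (f.eval z)⁻¹)
  set t := f.natDegree
  set S := ∑ i ∈ f.support, ‖f.coeff i‖
  have hS : 0 ≤ S := Finset.sum_nonneg fun i _ => norm_nonneg _
  refine ⟨t * K ^ t * M * S + 1, by positivity, fun n => ?_⟩
  have hwn := hw n
  have hterm : ∀ k ∈ Finset.range (n + 1),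
      ‖((phiW w k - phiW w n : ℝ) : ℂ) * g k * f.coeff (n - k)‖
        ≤ t * K ^ t / w n * M * ‖f.coeff (n - k)‖ := by
    intro k hk
    by_cases hc : n - k ≤ t
    · rw [norm_mul, norm_mul, Complex.norm_real, Real.norm_eq_abs]
      gcongr
      · exact abs_phiW_sub_phiW_le hw hK1 hK (Nat.lt_succ_iff.mp (Finset.mem_range.mp hk)) hc
      · exact hM k
    · simp [Polynomial.coeff_eq_zero_of_natDegree_lt (not_le.mp hc)]
  have hdiff : ‖∑ k ∈ Finset.range (n + 1),
      ((phiW w k - phiW w n : ℝ) : ℂ) * g k * f.coeff (n - k)‖ ≤ t * K ^ t / w n * M * S := by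
    refine (norm_sum_le_of_le _ hterm).trans ?_
    rw [← Finset.mul_sum]
    gcongr
    exact sum_norm_coeff_sub_le f n
  have hzero : ‖(phiW w n : ℂ) * (if n = 0 then 1 else 0)‖ ≤ 1 / w n := by
    split_ifs with h
    · subst h
      simp [phiW, abs_of_pos (hw 0)]
    · simpa using hwn.le
  have hsplit : ∑ k ∈ Finset.range (n + 1), (phiW w k : ℂ) * g k * f.coeff (n - k)
      = ∑ k ∈ Finset.range (n + 1), ((phiW w k - phiW w n : ℝ) : ℂ) * g k * f.coeff (n - k)
        + (phiW w n : ℂ) * (if n = 0 then 1 else 0) := by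
    rw [← sum_taylorCoeff_inv_mul_coeff f (hf0 0 (by simp)) n, Finset.mul_sum,
      ← Finset.sum_add_distrib]
    refine Finset.sum_congr rfl fun k _ => ?_
    push_cast
    ring
  calc _ ≤ t * K ^ t / w n * M * S + 1 / w n := by
        rw [hsplit]
        exact norm_add_le_of_le hdiff hzero
    _ = _ := by ring
end
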